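/- arXiv:1712.06198 — 2 statements merged into one kernel-verified Lean document; each statement's English description precedes it below -/
import Mathlib

section
/- Let L be a first-order language, let M1 and M2 be L-structures, and let h : M1 → M2 be an isomorphic embedding (an L-embedding). Then Ultrafilter.map h : Ultrafilter M1 → Ultrafilter M2 is an isomorphic embedding of the ultrafilter extension β(M1) into β(M2). (First Extension Theorem, embedding case.) -/
open FirstOrder Language

/-- Iterated ultrafilter quantifier. -/
def extProp {M : Type*} : ∀ {n : ℕ}, (Fin n → Ultrafilter M) → ((Fin n → M) → Prop) → Prop
  | 0, _, φ => φ Fin.elim0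
  | _ + 1, D, φ =>
      {a : M | extProp (fun i => D i.succ) (fun x => φ (Fin.cons a x))} ∈ D 0

/-- Ultrafilter extension of an `n`-ary function. -/
def extFun {M : Type*} : ∀ {n : ℕ}, (Fin n → Ultrafilter M) → ((Fin n → M) → M) → Ultrafilter M
  | 0, _, f => pure (f Fin.elim0)
  | _ + 1, D, f =>
      (D 0).bind fun a => extFun (fun i => D i.succ) (fun x => f (Fin.cons a x))

/-- The ultrafilter extension `β(M)` of an `L`-structure `M`. -/
noncomputable instance ultrafilterStructure (L : Language) (M : Type*) [L.Structure M] :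
    L.Structure (Ultrafilter M) where
  funMap f D := extFun D fun x => Structure.funMap f x
  RelMap r D := extProp D fun x => Structure.RelMap r x

theorem extProp_map {M N : Type*} (h : M → N) :
    ∀ {n : ℕ} (D : Fin n → Ultrafilter M) (φ : (Fin n → N) → Prop),
      extProp (fun i => (D i).map h) φ ↔ extProp D fun x => φ (h ∘ x)
  | 0, _, φ => by
    simp only [extProp]
    rw [Subsingleton.elim (h ∘ Fin.elim0) Fin.elim0]
  | n + 1, D, φ => by
    simp only [extProp, Ultrafilter.mem_map, Set.preimage_ofPred_eq, extProp_map h, Fin.comp_cons]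

theorem map_extFun {M N : Type*} (h : M → N) :
    ∀ {n : ℕ} (D : Fin n → Ultrafilter M) (f : (Fin n → M) → M) (g : (Fin n → N) → N),
      (∀ x, h (f x) = g (h ∘ x)) →
        (extFun D f).map h = extFun (fun i => (D i).map h) g
  | 0, _, f, g, hfg => by
    simp only [extFun, Ultrafilter.map_pure, hfg]
    rw [Subsingleton.elim (h ∘ Fin.elim0) Fin.elim0]
  | n + 1, D, f, g, hfg => by
    have key (a : M) := map_extFun h (fun i => D i.succ) (fun x => f (Fin.cons a x))
      (fun x => g (Fin.cons (h a) x)) fun x => by rw [hfg, Fin.comp_cons]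
    ext s
    change {a | h ⁻¹' s ∈ extFun (fun i => D i.succ) fun x => f (Fin.cons a x)} ∈ D 0 ↔
      {a | s ∈ extFun (fun i => (D i.succ).map h) fun x => g (Fin.cons (h a) x)} ∈ D 0
    simp only [← key, Ultrafilter.mem_map]

theorem Ultrafilter.map_injective {M N : Type*} {h : M → N} (hh : Function.Injective h) :
    Function.Injective (Ultrafilter.map h) := fun _ _ hD =>
  Ultrafilter.coe_injective (Filter.map_injective hh (congrArg Ultrafilter.toFilter hD))

/-- First Extension Theorem, embedding case: if `h : M1 → M2` is an isomorphic embedding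
(an `L`-embedding), then `Ultrafilter.map h` is an isomorphic embedding
of `β(M1)` into `β(M2)`. -/
theorem ultrafilterMap_isEmbedding (L : Language) (M1 M2 : Type*)
    [L.Structure M1] [L.Structure M2] (h : M1 ↪[L] M2) :
    ∃ g : Ultrafilter M1 ↪[L] Ultrafilter M2, ⇑g = Ultrafilter.map ⇑h := by
  refine ⟨⟨⟨Ultrafilter.map h, Ultrafilter.map_injective h.injective⟩, ?_, ?_⟩, rfl⟩
  · intro n f D
    exact map_extFun h D _ _ fun x => h.map_fun f x
  · intro n r D
    refine (extProp_map h D _).trans ?_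
    simp only [h.map_rel]
    rfl
end

section
/- Let M be a set, P ⊆ M, and F : M → M → M a binary operation such that F maps P × P into P and F is an unordered pairing function on P, i.e., for all a₁, b₁, a₂, b₂ ∈ P, F a₁ b₁ = F a₂ b₂ iff {a₁, b₁} = {a₂, b₂} as sets. Then for every ultrafilter D on M, the following are equivalent: (1) D = pure a for some a ∈ P; (2) P ∈ D and for every ultrafilter E on M with P ∈ E, F̃(D, E) = F̃(E, D). (Characterization of the 'central' elements of the ultrafilter extension as exactly the principal ultrafilters concentrated on P.) -/
/-- The ultrafilter extension of a binary operation `F : M → M → M`: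
`A ∈ ext2 F D₁ D₂` iff `{a | {b | F a b ∈ A} ∈ D₂} ∈ D₁`. -/
def ext2 {M : Type*} (F : M → M → M) (D₁ D₂ : Ultrafilter M) : Ultrafilter M :=
  D₁.bind fun a => Ultrafilter.map (F a) D₂

/-- The ultrafilter extension of a binary relation `R : M → M → Prop`:
`extRel R D₁ D₂` iff `{a | {b | R a b} ∈ D₂} ∈ D₁`. -/
def extRel {M : Type*} (R : M → M → Prop) (D₁ D₂ : Ultrafilter M) : Prop :=
  {a : M | {b : M | R a b} ∈ D₂} ∈ D₁

theorem mem_ext2 {M : Type*} (F : M → M → M) (D E : Ultrafilter M) (A : Set M) :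
    A ∈ ext2 F D E ↔ ∀ᶠ a in (D : Filter M), ∀ᶠ b in (E : Filter M), F a b ∈ A :=
  Iff.rfl

/-- Almost all pairs, in the iterated sense, are strictly increasing for a given well-order,
unless the ultrafilter is principal. -/
theorem Ultrafilter.eventually_eventually_lt {M : Type*} [LinearOrder M] [WellFoundedLT M]
    (D : Ultrafilter M) (hD : ∀ a, D ≠ pure a) :
    ∀ᶠ a in (D : Filter M), ∀ᶠ b in (D : Filter M), a < b := by
  by_contra h
  rw [← Ultrafilter.eventually_not] at h
  have hle : ∀ᶠ a in (D : Filter M), ∀ᶠ b in (D : Filter M), b ≤ a := by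
    filter_upwards [h] with a ha
    simpa only [not_lt] using Ultrafilter.eventually_not.mpr ha
  obtain ⟨a, ha, hmin⟩ := WellFounded.has_min (wellFounded_lt (α := M))
    {a | ∀ᶠ b in (D : Filter M), b ≤ a} hle.exists
  have hsing : ({a} : Set M) ∈ D := by
    filter_upwards [hle, ha] with b hb hba
    exact le_antisymm hba (not_lt.mp (hmin b hb))
  obtain ⟨x, rfl, hx⟩ := D.eq_pure_of_finite_mem (Set.finite_singleton a) hsing
  exact hD x hx

/-- A set in a nonprincipal ultrafilter contains a smaller such set which embeds into
its relative complement. -/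
theorem Ultrafilter.exists_mem_injOn_disjoint {M : Type*} (D : Ultrafilter M)
    (hD : ∀ a, D ≠ pure a) {P : Set M} (hP : P ∈ D) :
    ∃ X ∈ D, X ⊆ P ∧ ∃ g : M → M, Set.InjOn g X ∧ Set.MapsTo g X (P \ X) := by
  have hinf : Infinite P := Set.infinite_coe_iff.mpr fun hfin =>
    let ⟨a, _, ha⟩ := D.eq_pure_of_finite_mem hfin hP
    hD a ha
  obtain ⟨e⟩ : Nonempty (P ⊕ P ≃ P) := by
    rw [← Cardinal.eq, ← Cardinal.add_def]
    exact Cardinal.add_eq_self (Cardinal.aleph0_le_mk P)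
  have key : ∀ f h : P → M, Function.Injective f → Function.Injective h →
      (∀ x, f x ∈ P) → (∀ x, h x ∈ P) → (∀ x y, f x ≠ h y) → Set.range f ∈ D →
      ∃ X ∈ D, X ⊆ P ∧ ∃ g : M → M, Set.InjOn g X ∧ Set.MapsTo g X (P \ X) := by
    intro f h hf hh hfP hhP hne hmem
    refine ⟨Set.range f, hmem, Set.range_subset_iff.mpr hfP, Function.extend f h id, ?_, ?_⟩
    · rintro _ ⟨x, rfl⟩ _ ⟨y, rfl⟩ hxy
      rw [hf.extend_apply, hf.extend_apply] at hxy
      rw [hh hxy]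
    · rintro _ ⟨x, rfl⟩
      rw [hf.extend_apply]
      exact ⟨hhP x, fun ⟨y, hy⟩ => hne y x hy⟩
  have hl : Function.Injective fun x : P => (e (Sum.inl x) : M) :=
    Subtype.val_injective.comp (e.injective.comp Sum.inl_injective)
  have hr : Function.Injective fun x : P => (e (Sum.inr x) : M) :=
    Subtype.val_injective.comp (e.injective.comp Sum.inr_injective)
  have hlr : ∀ x y : P, (e (Sum.inl x) : M) ≠ e (Sum.inr y) := fun x y hxy =>
    Sum.inl_ne_inr (e.injective (Subtype.val_injective hxy))
  have hcover : Set.range (fun x : P => (e (Sum.inl x) : M)) ∪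
      Set.range (fun x : P => (e (Sum.inr x) : M)) ∈ D := by
    filter_upwards [hP] with a ha
    obtain ⟨x | x, hx⟩ := e.surjective ⟨a, ha⟩
    · exact Or.inl ⟨x, congrArg Subtype.val hx⟩
    · exact Or.inr ⟨x, congrArg Subtype.val hx⟩
  rcases Ultrafilter.union_mem_iff.mp hcover with h | h
  · exact key _ _ hl hr (fun x => (e _).2) (fun x => (e _).2) hlr h
  · exact key _ _ hr hl (fun x => (e _).2) (fun x => (e _).2) (fun x y => (hlr y x).symm) h

/-- Characterization of the "central" elements: if `F` maps `P × P` into `P` and is an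
unordered pairing function on `P`, then an ultrafilter `D` is principal at a point of `P`
iff `P ∈ D` and `D` commutes (under `F̃`) with every ultrafilter concentrated on `P`. -/
theorem central_iff_principal_on {M : Type*} (P : Set M) (F : M → M → M)
    (hmap : ∀ a ∈ P, ∀ b ∈ P, F a b ∈ P)
    (hF : ∀ a₁ ∈ P, ∀ b₁ ∈ P, ∀ a₂ ∈ P, ∀ b₂ ∈ P,
      (F a₁ b₁ = F a₂ b₂ ↔ ({a₁, b₁} : Set M) = {a₂, b₂}))
    (D : Ultrafilter M) :
    (∃ a ∈ P, D = pure a) ↔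
      (P ∈ D ∧ ∀ E : Ultrafilter M, P ∈ E → ext2 F D E = ext2 F E D) := by
  constructor
  · rintro ⟨a, ha, rfl⟩
    refine ⟨ha, fun E hE => Ultrafilter.ext fun A => ?_⟩
    rw [mem_ext2, mem_ext2]
    simp only [Ultrafilter.coe_pure, Filter.eventually_pure]
    refine Filter.eventually_congr ?_
    filter_upwards [hE] with b hb
    rw [(hF a ha b hb b hb a ha).mpr (Set.pair_comm a b)]
  · rintro ⟨hP, hcomm⟩
    by_contra! hne
    have hD : ∀ a, D ≠ pure a := by
      rintro a rfl
      exact hne a hP rfl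
    obtain ⟨X, hX, hXP, g, hg, hgX⟩ := D.exists_mem_injOn_disjoint hD hP
    obtain ⟨_, _⟩ := exists_wellFoundedLT M
    have hlt := D.eventually_eventually_lt hD
    let A : Set M := {c | ∃ a ∈ X, ∃ b ∈ X, a < b ∧ c = F a (g b)}
    have hA : A ∈ ext2 F D (D.map g) := by
      rw [mem_ext2]
      filter_upwards [hX, hlt] with a ha hab
      rw [Ultrafilter.coe_map, Filter.eventually_map]
      filter_upwards [hX, hab] with b hb hab
      exact ⟨a, ha, b, hb, hab, rfl⟩
    have hgP : P ∈ D.map g := Ultrafilter.mem_map.mpr <|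
      Filter.mem_of_superset hX fun x hx => (hgX hx).1
    rw [hcomm _ hgP, mem_ext2, Ultrafilter.coe_map, Filter.eventually_map] at hA
    obtain ⟨b, hb, hba, hbA⟩ := (Filter.Eventually.and hX (hlt.and hA)).exists
    obtain ⟨a, ha, hlt_ba, a', ha', b', hb', hab', heq⟩ :=
      (Filter.Eventually.and hX (hba.and hbA)).exists
    rw [hF _ (hgX hb).1 _ (hXP ha) _ (hXP ha') _ (hgX hb').1, Set.pair_eq_pair_iff] at heq
    rcases heq with ⟨h, -⟩ | ⟨h, rfl⟩
    · exact (hgX hb).2 (h ▸ ha')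
    · obtain rfl := hg hb hb' h
      exact lt_asymm hlt_ba hab'
end
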